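/- Let N ≥ 1 and c ≥ 1 be coprime integers, let d be a positive divisor of N, and let n be an integer. Let N̄ denote the multiplicative inverse of N modulo c. Then ∑_{a=0}^{c-1} S(N̄³, (ad)², c) e(an/c) = ∑_{a=0}^{c-1} S(N, a², c) e(a n (N²/d) / c). In particular (taking n = 0), ∑_{a=0}^{c-1} S(N̄³, (ad)², c) = ∑_{a=0}^{c-1} S(N, a², c). -/

import Mathlib

open Complex Finset

/-- `e(x) = exp(2πix)`. -/
noncomputable def eC (x : ℂ) : ℂ := Complex.exp (2 * Real.pi * Complex.I * x)

/-- The Kloosterman sum `S(m, n; c) = ∑_{a mod c, (a,c)=1} e((ma + n a⁻¹)/c)`. -/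
noncomputable def kloosterman (m n : ℤ) (c : ℕ) : ℂ :=
  ∑ a ∈ (Finset.range c).filter (fun a => Nat.gcd a c = 1),
    eC ((m * a + n * (((a : ZMod c)⁻¹).val : ℕ)) / c)

theorem eC_intCast_div (c : ℕ) [NeZero c] (z : ℤ) :
    eC ((z : ℂ) / c) = ZMod.stdAddChar (z : ZMod c) := by
  rw [ZMod.stdAddChar_coe, eC]
  congr 1
  ring

theorem sum_range_natCast_zmod {M : Type*} [AddCommMonoid M] (c : ℕ) [NeZero c]
    (f : ZMod c → M) : ∑ a ∈ Finset.range c, f (a : ZMod c) = ∑ x : ZMod c, f x := by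
  refine Finset.sum_bij' (fun a _ => (a : ZMod c)) (fun x _ => x.val) ?_ ?_ ?_ ?_ ?_
  · intros; exact Finset.mem_univ _
  · intro x _; exact Finset.mem_range.mpr x.val_lt
  · intro a ha; exact ZMod.val_cast_of_lt (Finset.mem_range.mp ha)
  · intro x _; exact ZMod.natCast_zmod_val x
  · intros; rfl

/-- The Kloosterman sum with parameters in `ZMod c`. -/
noncomputable def zmodKloosterman {c : ℕ} [NeZero c] (m n : ZMod c) : ℂ :=
  ∑ u : (ZMod c)ˣ, ZMod.stdAddChar (m * (u : ZMod c) + n * ((u⁻¹ : (ZMod c)ˣ) : ZMod c))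

theorem zmodKloosterman_mul_unit {c : ℕ} [NeZero c] (m n : ZMod c) (v : (ZMod c)ˣ) :
    zmodKloosterman m (n * (v : ZMod c)) = zmodKloosterman (m * (v : ZMod c)) n := by
  unfold zmodKloosterman
  refine Fintype.sum_equiv (Equiv.mulLeft v⁻¹) _ _ fun u => ?_
  simp only [Equiv.coe_mulLeft, mul_inv, inv_inv, Units.val_mul]
  congr 1
  linear_combination (-(m * u)) * v.mul_inv

theorem kloosterman_eq_zmodKloosterman (m n : ℤ) (c : ℕ) [NeZero c] :
    kloosterman m n c = zmodKloosterman (m : ZMod c) (n : ZMod c) := by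
  unfold kloosterman zmodKloosterman
  refine Finset.sum_bij'
    (fun a ha => ZMod.unitOfCoprime a (Finset.mem_filter.mp ha).2)
    (fun u _ => (u : ZMod c).val) ?_ ?_ ?_ ?_ ?_
  · intros; exact Finset.mem_univ _
  · intro u _
    exact Finset.mem_filter.mpr
      ⟨Finset.mem_range.mpr (ZMod.val_lt _), ZMod.val_coe_unit_coprime u⟩
  · intro a ha
    exact ZMod.val_cast_of_lt (Finset.mem_range.mp (Finset.mem_filter.mp ha).1)
  · intro u _
    ext
    simp
  · intro a ha
    rw [← ZMod.inv_coe_unit, ZMod.coe_unitOfCoprime]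
    have h := eC_intCast_div c (m * a + n * (((a : ZMod c)⁻¹).val : ℕ))
    push_cast [ZMod.natCast_zmod_val] at h
    exact h

/-- The change of variables `a ↦ a t` for a unit `t`, with `t s = q²`, followed by rescaling the
Kloosterman sum by `q⁴`. -/
theorem sum_zmodKloosterman_rescale {c : ℕ} [NeZero c] (q : (ZMod c)ˣ) (s t k : ZMod c)
    (hst : t * s = (q : ZMod c) ^ 2) :
    ∑ x : ZMod c, zmodKloosterman (((q⁻¹ : (ZMod c)ˣ) : ZMod c) ^ 3) ((x * s) ^ 2) *
        ZMod.stdAddChar (x * k) =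
      ∑ x : ZMod c, zmodKloosterman (q : ZMod c) (x ^ 2) * ZMod.stdAddChar (x * k * t) := by
  have ht : IsUnit t := isUnit_of_mul_isUnit_left (hst ▸ q.isUnit.pow 2)
  obtain ⟨t, rfl⟩ := ht
  refine (Fintype.sum_equiv (Units.mulRight t) _ _ fun x => ?_).symm
  have h₁ : (x * t * s) ^ 2 = x ^ 2 * ((q ^ 4 : (ZMod c)ˣ) : ZMod c) := by
    rw [mul_assoc, hst]
    push_cast
    ring
  have h₂ : ((q⁻¹ : (ZMod c)ˣ) : ZMod c) ^ 3 * ((q ^ 4 : (ZMod c)ˣ) : ZMod c) = q := by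
    norm_cast
    group
  rw [Units.mulRight_apply, h₁, zmodKloosterman_mul_unit, h₂, mul_right_comm x k]

theorem sum_kloosterman_rescale (N c : ℕ) (hc : 1 ≤ c) (hNc : Nat.Coprime N c)
    (d : ℕ) (hd : d ∣ N) (n : ℤ) :
    ∑ a ∈ Finset.range c,
        kloosterman ((((N : ZMod c)⁻¹).val : ℤ) ^ 3) (((a * d : ℕ) : ℤ) ^ 2) c *
          eC ((a : ℂ) * (n : ℂ) / (c : ℂ)) =
      ∑ a ∈ Finset.range c,
        kloosterman (N : ℤ) ((a : ℤ) ^ 2) c *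
          eC ((a : ℂ) * (n : ℂ) * ((N ^ 2 / d : ℕ) : ℂ) / (c : ℂ)) := by
  have : NeZero c := ⟨by omega⟩
  have hq : ((ZMod.unitOfCoprime N hNc : (ZMod c)ˣ) : ZMod c) = N :=
    ZMod.coe_unitOfCoprime N hNc
  have hst : ((N ^ 2 / d : ℕ) : ZMod c) * d =
      ((ZMod.unitOfCoprime N hNc : (ZMod c)ˣ) : ZMod c) ^ 2 := by
    rw [hq]
    exact_mod_cast congrArg (Nat.cast : ℕ → ZMod c)
      (Nat.div_mul_cancel (hd.trans (dvd_pow_self N two_ne_zero)))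
  have key := sum_zmodKloosterman_rescale _ (d : ZMod c) _ (n : ZMod c) hst
  rw [← ZMod.inv_coe_unit, hq, ← sum_range_natCast_zmod, ← sum_range_natCast_zmod] at key
  convert key using 2 with a _ a _
  · have h := eC_intCast_div c (a * n)
    push_cast at h
    rw [kloosterman_eq_zmodKloosterman, h]
    push_cast [ZMod.natCast_zmod_val]
    rfl
  · have h := eC_intCast_div c (a * n * (N ^ 2 / d : ℕ))
    rw [Int.cast_mul, Int.cast_mul, Int.cast_natCast, Int.cast_natCast, Int.cast_mul,
      Int.cast_mul, Int.cast_natCast, Int.cast_natCast] at h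
    rw [kloosterman_eq_zmodKloosterman, h]
    push_cast
    rfl

/-- for `(N,c)=1`, `d | N`, and `N̄` the inverse of `N` mod `c`,
`∑_{a mod c} S(N̄³, (ad)²; c) e(an/c) = ∑_{a mod c} S(N, a²; c) e(a n (N²/d)/c)`;
in particular (`n = 0`), `∑_{a mod c} S(N̄³, (ad)²; c) = ∑_{a mod c} S(N, a²; c)`. -/
theorem statement_5 (N c : ℕ) (hN : 1 ≤ N) (hc : 1 ≤ c) (hNc : Nat.Coprime N c)
    (d : ℕ) (hd : d ∣ N) (hd0 : 0 < d) (n : ℤ)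
    (Nbar : ℤ) (hNbar : Nbar = (((N : ZMod c)⁻¹).val : ℤ)) :
    (∑ a ∈ Finset.range c,
        kloosterman (Nbar ^ 3) (((a * d : ℕ) : ℤ) ^ 2) c * eC ((a : ℂ) * (n : ℂ) / (c : ℂ)) =
      ∑ a ∈ Finset.range c,
        kloosterman (N : ℤ) ((a : ℤ) ^ 2) c *
          eC ((a : ℂ) * (n : ℂ) * ((N ^ 2 / d : ℕ) : ℂ) / (c : ℂ))) ∧
    (∑ a ∈ Finset.range c, kloosterman (Nbar ^ 3) (((a * d : ℕ) : ℤ) ^ 2) c =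
      ∑ a ∈ Finset.range c, kloosterman (N : ℤ) ((a : ℤ) ^ 2) c) := by
  subst hNbar
  refine ⟨sum_kloosterman_rescale N c hc hNc d hd n, ?_⟩
  simpa [eC] using sum_kloosterman_rescale N c hc hNc d hd 0
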